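/- Let l ≥ 2 be an integer and let n = C(2l+1, l) + 1. Then the least number of colours in a distinguishing arc-colouring of the complete symmetric digraph ↔K_n with no monochromatic 2-path is at most 1 plus the least number of colours in a proper arc-colouring of type I of the complete symmetric digraph ↔K_{⌈n/2⌉}. -/

import Mathlib

/-- A type-I proper arc-colouring of the symmetric digraph of `G`:
no monochromatic 2-cycle and no monochromatic 2-path. -/
def IsTypeIColouring {V : Type*} (G : SimpleGraph V) {k : ℕ} (c : V → V → Fin k) : Prop :=
  ∀ u v w : V, G.Adj u v → G.Adj v w → c u v ≠ c v w

/-- An arc-colouring of the symmetric digraph of `G` with no monochromatic 2-path. -/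
def NoMono2Path {V : Type*} (G : SimpleGraph V) {k : ℕ} (c : V → V → Fin k) : Prop :=
  ∀ u v w : V, G.Adj u v → G.Adj v w → w ≠ u → c u v ≠ c v w

/-- An arc-colouring is distinguishing if the identity is the only automorphism
of `G` preserving it. -/
def IsDistinguishing {V : Type*} (G : SimpleGraph V) {k : ℕ} (c : V → V → Fin k) : Prop :=
  ∀ φ : G ≃g G, (∀ u v : V, G.Adj u v → c (φ u) (φ v) = c u v) → ∀ x : V, φ x = x

section

open Finset

/-- Doubling an antichain: if each vertex lies in a block together with at most one other vertex,
an extra colour inside the blocks and independent choices of colours in `O p \ O q` between the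
blocks give a distinguishing colouring with no monochromatic 2-path. -/
theorem exists_distinguishing_of_blocks {V B : Type*} {r : ℕ} (b : V → B) (s : V → Bool)
    (hinj : ∀ u v, b u = b v → s u = s v → u = v) (hsurj : Function.Surjective b)
    (O : B → Finset (Fin r)) (g : Bool → B → B → Fin r)
    (hg : ∀ i p q, p ≠ q → g i p q ∈ O p \ O q)
    (hne : ∀ p, ∃ q, p ≠ q ∧ g true p q ≠ g false p q) :
    ∃ c : V → V → Fin (r + 1),
      NoMono2Path (⊤ : SimpleGraph V) c ∧ IsDistinguishing (⊤ : SimpleGraph V) c := by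
  classical
  let c : V → V → Fin (r + 1) := fun u v =>
    if b u = b v then Fin.last r else (g (s u) (b u) (b v)).castSucc
  have c_same : ∀ {u v}, b u = b v → c u v = Fin.last r := fun h => if_pos h
  have c_diff : ∀ {u v}, b u ≠ b v → c u v = (g (s u) (b u) (b v)).castSucc := fun h => if_neg h
  have last_ne : ∀ x : Fin r, x.castSucc ≠ Fin.last r := fun x => (Fin.castSucc_lt_last x).ne
  refine ⟨c, ?_, ?_⟩
  · intro u v w huv hvw hwu h
    rw [SimpleGraph.top_adj] at huv hvw
    by_cases h1 : b u = b v <;> by_cases h2 : b v = b w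
    · have h3 : s u ≠ s v := fun e => huv (hinj _ _ h1 e)
      have h4 : s v ≠ s w := fun e => hvw (hinj _ _ h2 e)
      refine hwu (hinj _ _ (h1.trans h2).symm ?_)
      revert h3 h4
      cases s u <;> cases s v <;> cases s w <;> simp
    · rw [c_same h1, c_diff h2] at h
      exact last_ne _ h.symm
    · rw [c_diff h1, c_same h2] at h
      exact last_ne _ h
    · rw [c_diff h1, c_diff h2] at h
      have h3 := hg (s u) _ _ h1
      have h4 := hg (s v) _ _ h2
      rw [Fin.castSucc_injective _ h] at h3
      exact (mem_sdiff.1 h3).2 (mem_sdiff.1 h4).1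
  · intro φ hφ
    have block_fixed : ∀ x, b (φ x) = b x := by
      intro x
      by_contra hx
      obtain ⟨w, hw⟩ := φ.surjective x
      have hxw : x ≠ w := by
        rintro rfl
        exact hx (congrArg b hw)
      have h := hφ x w hxw
      rw [hw, c_diff hx] at h
      by_cases h1 : b x = b w
      · rw [c_same h1] at h
        exact last_ne _ h
      · rw [c_diff h1] at h
        have h3 := hg (s (φ x)) _ _ hx
        rw [Fin.castSucc_injective _ h] at h3
        exact (mem_sdiff.1 h3).2 (mem_sdiff.1 (hg (s x) _ _ h1)).1
    intro x
    refine hinj _ _ (block_fixed x) ?_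
    by_contra hs
    obtain ⟨q, hq, hgq⟩ := hne (b x)
    obtain ⟨y, rfl⟩ := hsurj q
    have h := hφ x y (fun e => hq (congrArg b e))
    rw [c_diff hq, c_diff (by rwa [block_fixed, block_fixed]), block_fixed, block_fixed] at h
    have h' := Fin.castSucc_injective _ h
    revert h' hs
    cases s (φ x) <;> cases s x <;> simp [hgq, hgq.symm]

/-- The out-colours of the vertices under a type-I colouring form an antichain. -/
theorem IsTypeIColouring.card_le {V : Type*} [Fintype V] {k : ℕ} {c : V → V → Fin k}
    (hc : IsTypeIColouring (⊤ : SimpleGraph V) c) :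
    Fintype.card V ≤ k.choose (k / 2) := by
  classical
  let out : V → Finset (Fin k) := fun u => (univ.filter (u ≠ ·)).image (c u)
  have not_sub : ∀ u v, u ≠ v → ¬ out u ⊆ out v := by
    intro u v huv hsub
    have h : c u v ∈ out u := mem_image_of_mem _ (by simpa using huv)
    obtain ⟨w, hw, hcw⟩ := mem_image.1 (hsub h)
    exact hc u v w huv (by simpa using hw) hcw.symm
  have out_inj : Function.Injective out := by
    intro u v h
    by_contra huv
    exact not_sub u v huv h.le
  have anti : IsAntichain (· ⊆ ·) (SetLike.coe (univ.image out)) := by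
    intro A hA B hB hAB
    simp only [coe_image, coe_univ, Set.image_univ, Set.mem_range] at hA hB
    obtain ⟨u, rfl⟩ := hA
    obtain ⟨v, rfl⟩ := hB
    exact not_sub u v (fun e => hAB (congrArg out e))
  have := anti.sperner
  rwa [card_image_of_injective _ out_inj, card_univ, Fintype.card_fin] at this

/-- Few sets of the same size differ from `A` in at most one element. -/
theorem card_le_of_card_sdiff_le_one {α : Type*} [Fintype α] [DecidableEq α]
    (A : Finset α) (F : Finset (Finset α)) (hcard : ∀ B ∈ F, #B = #A)
    (hF : ∀ B ∈ F, #(A \ B) ≤ 1) : #F ≤ #A * #Aᶜ + 1 := by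
  have hsub : F ⊆ insert A ((A ×ˢ Aᶜ).image fun x => insert x.2 (A.erase x.1)) := by
    intro B hB
    rw [mem_insert]
    by_cases hAB : A ⊆ B
    · exact Or.inl (eq_of_subset_of_card_le hAB (hcard B hB).le).symm
    right
    have h1 : #(A \ B) = 1 :=
      le_antisymm (hF B hB) (card_pos.2 (sdiff_nonempty.2 hAB))
    have h2 : #(B \ A) = 1 := by rw [← h1, card_sdiff_comm (hcard B hB)]
    obtain ⟨a, ha⟩ := card_eq_one.1 h1
    obtain ⟨b, hb⟩ := card_eq_one.1 h2
    have ha' : ∀ x, x ∈ A ∧ x ∉ B ↔ x = a := fun x => by rw [← mem_sdiff, ha, mem_singleton]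
    have hb' : ∀ x, x ∈ B ∧ x ∉ A ↔ x = b := fun x => by rw [← mem_sdiff, hb, mem_singleton]
    refine mem_image.2 ⟨(a, b), ?_, ?_⟩
    · simpa using ⟨((ha' a).2 rfl).1, ((hb' b).2 rfl).2⟩
    · ext x
      have := ha' x
      have := hb' x
      simp only [mem_insert, mem_erase]
      tauto
  calc #F ≤ _ := card_le_card hsub
    _ ≤ _ := card_insert_le _ _
    _ ≤ _ := by
      rw [← card_product]
      exact Nat.add_le_add_right card_image_le 1

theorem two_mul_sq_add_two_le_choose {l : ℕ} (hl : 2 ≤ l) :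
    2 * l ^ 2 + 2 ≤ (2 * l + 1).choose l := by
  induction l, hl using Nat.le_induction with
  | base => decide
  | succ l hl ih =>
    have h1 : (2 * (l + 1) + 1).choose (l + 1)
        = (2 * l + 2).choose l + (2 * l + 2).choose (l + 1) := Nat.choose_succ_succ _ _
    have h2 : (2 * l + 2).choose (l + 1)
        = (2 * l + 1).choose l + (2 * l + 1).choose (l + 1) := Nat.choose_succ_succ _ _
    have h3 := Nat.choose_symm_half l
    nlinarith

theorem choose_add_two_le {l : ℕ} (hl : 2 ≤ l) :
    (2 * l + 1).choose l + 2 ≤ 2 * (2 * l).choose l := by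
  obtain ⟨j, rfl⟩ : ∃ j, l = j + 1 := ⟨l - 1, by omega⟩
  have h1 : (2 * (j + 1) + 1).choose (j + 1)
      = (2 * (j + 1)).choose j + (2 * (j + 1)).choose (j + 1) := Nat.choose_succ_succ _ _
  have h2 := Nat.choose_succ_right_eq (2 * (j + 1)) j
  rw [show 2 * (j + 1) - j = j + 2 by omega] at h2
  have h3 := Nat.choose_le_centralBinom 1 (j + 1)
  rw [Nat.centralBinom_eq_two_mul_choose, Nat.choose_one_right] at h3
  rw [h1]
  nlinarith

/-- Any family of many `l`-subsets of a `2l`-set indexes the blocks of a colouring as in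
`exists_distinguishing_of_blocks`. -/
theorem exists_distinguishing_colouring {l m n : ℕ} (hm : m = (n + 1) / 2)
    (hlow : l ^ 2 + 2 ≤ m) (hupp : m ≤ (2 * l).choose l) :
    ∃ c : Fin n → Fin n → Fin (2 * l + 1),
      NoMono2Path (⊤ : SimpleGraph (Fin n)) c ∧
      IsDistinguishing (⊤ : SimpleGraph (Fin n)) c := by
  obtain ⟨F, hF, hFm⟩ := exists_subset_card_eq
    (s := powersetCard l (univ : Finset (Fin (2 * l)))) (n := m)
    (by rwa [card_powersetCard, card_univ, Fintype.card_fin])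
  let O : Fin m ≃ F := (F.equivFinOfCardEq hFm).symm
  have cardO : ∀ B ∈ F, #B = l := fun B hB => (mem_powersetCard.1 (hF hB)).2
  have choice : ∀ p q : Fin m, ∃ x y : Fin (2 * l), p ≠ q →
      x ∈ (O p).1 \ (O q).1 ∧ y ∈ (O p).1 \ (O q).1 ∧
      (2 ≤ #((O p).1 \ (O q).1) → x ≠ y) := by
    intro p q
    by_cases hpq : p = q
    · have : 0 < l := by
        have := p.2
        rcases Nat.eq_zero_or_pos l with rfl | h
        · simp at hupp; omega
        · exact h
      exact ⟨⟨0, by omega⟩, ⟨0, by omega⟩, fun h => (h hpq).elim⟩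
    by_cases h2 : 2 ≤ #((O p).1 \ (O q).1)
    · obtain ⟨x, hx, y, hy, hxy⟩ := one_lt_card.1 h2
      exact ⟨x, y, fun _ => ⟨hx, hy, fun _ => hxy⟩⟩
    · have : ¬ (O p).1 ⊆ (O q).1 := fun h => hpq <| O.injective <| Subtype.ext <|
        eq_of_subset_of_card_le h (by rw [cardO _ (O p).2, cardO _ (O q).2])
      obtain ⟨x, hx⟩ := sdiff_nonempty.2 this
      exact ⟨x, x, fun _ => ⟨hx, hx, fun h => (h2 h).elim⟩⟩
  choose x y hxy using choice
  refine exists_distinguishing_of_blocks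
    (fun u : Fin n => (⟨u / 2, by omega⟩ : Fin m)) (fun u => decide (u.1 % 2 = 0)) ?_ ?_
    (fun p => (O p).1) (fun i p q => if i then x p q else y p q) ?_ ?_
  · intro u v h1 h2
    simp only [Fin.mk.injEq, decide_eq_decide] at h1 h2
    ext
    omega
  · intro p
    have := p.2
    refine ⟨⟨2 * p.1, by omega⟩, ?_⟩
    ext
    simp
  · intro i p q hpq
    cases i
    · exact (hxy p q hpq).2.1
    · exact (hxy p q hpq).1
  · intro p
    have hp := cardO _ (O p).2
    obtain ⟨B, hB, hB2⟩ : ∃ B ∈ F, 2 ≤ #((O p).1 \ B) := by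
      by_contra! hcon
      have := card_le_of_card_sdiff_le_one (O p).1 F (fun B hB => by rw [cardO B hB, hp])
        (fun B hB => Nat.le_of_lt_succ (hcon B hB))
      rw [card_compl, hp, Fintype.card_fin, hFm, show 2 * l - l = l by omega] at this
      nlinarith
    obtain ⟨q, hq⟩ := O.surjective ⟨B, hB⟩
    have hq' : (O q).1 = B := congrArg Subtype.val hq
    have hpq : p ≠ q := by
      rintro rfl
      simp [hq'] at hB2
    exact ⟨q, hpq, by simpa using (hxy p q hpq).2.2 (by rwa [hq'])⟩

end

theorem stmt17 (l : ℕ) (hl : 2 ≤ l) (n : ℕ) (hn : n = (2 * l + 1).choose l + 1) :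
    sInf {k : ℕ | ∃ c : Fin n → Fin n → Fin k,
        NoMono2Path (⊤ : SimpleGraph (Fin n)) c ∧
        IsDistinguishing (⊤ : SimpleGraph (Fin n)) c} ≤
    1 + sInf {k : ℕ | ∃ c : Fin ((n + 1) / 2) → Fin ((n + 1) / 2) → Fin k,
        IsTypeIColouring (⊤ : SimpleGraph (Fin ((n + 1) / 2))) c} := by
  have hlow := two_mul_sq_add_two_le_choose hl
  have hupp := choose_add_two_le hl
  set m := (n + 1) / 2 with hm
  have hk : 2 * l ≤ sInf {k : ℕ | ∃ c : Fin m → Fin m → Fin k,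
      IsTypeIColouring (⊤ : SimpleGraph (Fin m)) c} := by
    refine le_csInf ⟨m, fun u _ => u, fun u v _ huv _ => huv⟩ ?_
    rintro k ⟨c, hc⟩
    by_contra! hlt
    have h1 := hc.card_le
    rw [Fintype.card_fin] at h1
    obtain ⟨j, rfl⟩ : ∃ j, l = j + 1 := ⟨l - 1, by omega⟩
    have h2 : k.choose (k / 2) ≤ (2 * j + 1).choose j :=
      (Nat.choose_le_choose _ (by omega : k ≤ 2 * j + 1)).trans
        ((Nat.choose_le_middle _ _).trans_eq (by congr 1; omega))
    have h3 : (2 * (j + 1)).choose (j + 1)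
        = (2 * j + 1).choose j + (2 * j + 1).choose (j + 1) := Nat.choose_succ_succ _ _
    have h4 := Nat.choose_symm_half j
    have h5 := Nat.choose_le_choose (j + 1) (by omega : 2 * (j + 1) ≤ 2 * (j + 1) + 1)
    omega
  calc _ ≤ 2 * l + 1 :=
        Nat.sInf_le (exists_distinguishing_colouring (l := l) hm (by omega) (by omega))
    _ ≤ _ := by omega
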